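/- arXiv:2402.18398 — 4 statements merged into one kernel-verified Lean document; each statement's English description precedes it below -/
import Mathlib

section
/- For every n ≥ 1, the 2^n × 2^n matrix S⁻ := ∑_{j=1}^n s_j⁻ equals the lower shift operator in the computational basis, i.e. S⁻ = ∑_{k=1}^{2^n−1} |k−1⟩⟨k| (its (a,b)-entry equals 1 if b = a+1 and 0 otherwise), and S⁺ := ∑_{j=1}^n s_j⁺ equals the conjugate transpose (S⁻)†, i.e. the upper shift ∑_{k=1}^{2^n−1} |k⟩⟨k−1|. -/
/-!
STATEMENT 0. For every n ≥ 1, the matrix S⁻ := ∑_{j=1}^n s_j⁻ equals the lower shift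
operator in the computational basis, and S⁺ := ∑_{j=1}^n s_j⁺ equals (S⁻)†, the upper shift.

We work with matrices indexed by bit strings `Fin n → Fin 2`, where index `k = 0` corresponds
to the leftmost (most significant) Kronecker factor; `tens M` is the Kronecker product
`M 0 ⊗ M 1 ⊗ ⋯ ⊗ M (n-1)`, and `bval a` is the number whose binary digits are the bits of `a`,
so that `fun a => bval a` realizes the identification `(Fin n → Fin 2) ≃ Fin (2^n)` used for the
computational basis `|k⟩`.
-/

open Matrix

noncomputable section

/-- `σ01 = |0⟩⟨1|`. -/
def sig01 : Matrix (Fin 2) (Fin 2) ℂ := !![0, 1; 0, 0]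

/-- `σ10 = |1⟩⟨0|`. -/
def sig10 : Matrix (Fin 2) (Fin 2) ℂ := !![0, 0; 1, 0]

/-- `n`-fold Kronecker product of single-qubit matrices, as a matrix indexed by bit strings. -/
def tens {n : ℕ} (M : Fin n → Matrix (Fin 2) (Fin 2) ℂ) :
    Matrix (Fin n → Fin 2) (Fin n → Fin 2) ℂ :=
  Matrix.of fun a b => ∏ k, M k (a k) (b k)

/-- `s_j⁻ = I^{⊗(n−j)} ⊗ σ01 ⊗ σ10^{⊗(j−1)}` for `1 ≤ j ≤ n`. -/
def sMinus (n j : ℕ) : Matrix (Fin n → Fin 2) (Fin n → Fin 2) ℂ :=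
  tens fun k => if (k : ℕ) < n - j then 1 else if (k : ℕ) = n - j then sig01 else sig10

/-- `s_j⁺ = I^{⊗(n−j)} ⊗ σ10 ⊗ σ01^{⊗(j−1)}` for `1 ≤ j ≤ n`. -/
def sPlus (n j : ℕ) : Matrix (Fin n → Fin 2) (Fin n → Fin 2) ℂ :=
  tens fun k => if (k : ℕ) < n - j then 1 else if (k : ℕ) = n - j then sig10 else sig01

/-- The number (in `[0, 2^n)`) encoded in binary by a bit string, most significant bit first. -/
def bval {n : ℕ} (a : Fin n → Fin 2) : ℕ := ∑ k, (a k : ℕ) * 2 ^ (n - 1 - (k : ℕ))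

theorem bval_cons {n : ℕ} (x : Fin 2) (a : Fin n → Fin 2) :
    bval (Fin.cons x a : Fin (n + 1) → Fin 2) = x * 2 ^ n + bval a := by
  simp only [bval, Fin.sum_univ_succ, Fin.cons_zero, Fin.cons_succ, Fin.val_zero, Fin.val_succ]
  congr 1
  refine Finset.sum_congr rfl fun k _ => ?_
  congr 2
  omega

theorem bval_lt_two_pow {n : ℕ} (a : Fin n → Fin 2) : bval a < 2 ^ n := by
  induction a using Fin.consInduction with
  | elim0 => simp [bval]
  | cons x a ih =>
    rw [bval_cons, pow_succ]
    fin_cases x <;> simp <;> omega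

theorem tens_cons {n : ℕ} (M : Fin (n + 1) → Matrix (Fin 2) (Fin 2) ℂ) (x y : Fin 2)
    (a b : Fin n → Fin 2) :
    tens M (Fin.cons x a) (Fin.cons y b) = M 0 x y * tens (fun k => M k.succ) a b := by
  simp [tens, Fin.prod_univ_succ]

/-- `σ10^{⊗n} = |2^n - 1⟩⟨0|`. -/
theorem tens_sig10_apply (n : ℕ) (a b : Fin n → Fin 2) :
    tens (fun _ => sig10) a b = if bval b + 2 ^ n = bval a + 1 then 1 else 0 := by
  induction n with
  | zero => simp [tens, bval]
  | succ n ih =>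
    induction a using Fin.consCases with | _ x a
    induction b using Fin.consCases with | _ y b
    have ha := bval_lt_two_pow a
    have hb := bval_lt_two_pow b
    rw [tens_cons, ih, bval_cons, bval_cons, pow_succ]
    fin_cases x <;> fin_cases y <;> simp [sig10] <;> grind

theorem sMinus_succ_cons {n j : ℕ} (hj : j ≤ n) (x y : Fin 2) (a b : Fin n → Fin 2) :
    sMinus (n + 1) j (Fin.cons x a) (Fin.cons y b) =
      (1 : Matrix (Fin 2) (Fin 2) ℂ) x y * sMinus n j a b := by
  have hlt (k : ℕ) : k + 1 < n + 1 - j ↔ k < n - j := by omega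
  have heq (k : ℕ) : k + 1 = n + 1 - j ↔ k = n - j := by omega
  have hpos : 0 < n + 1 - j := by omega
  simp [sMinus, tens_cons, hlt, heq, hpos]

theorem sMinus_self_cons (n : ℕ) (x y : Fin 2) (a b : Fin n → Fin 2) :
    sMinus (n + 1) (n + 1) (Fin.cons x a) (Fin.cons y b) =
      sig01 x y * tens (fun _ => sig10) a b := by
  simp [sMinus, tens_cons]

theorem sum_sMinus_apply (n : ℕ) (a b : Fin n → Fin 2) :
    (∑ j ∈ Finset.Icc 1 n, sMinus n j) a b = if bval b = bval a + 1 then 1 else 0 := by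
  induction n with
  | zero => simp [bval]
  | succ n ih =>
    induction a using Fin.consCases with | _ x a
    induction b using Fin.consCases with | _ y b
    have ha := bval_lt_two_pow a
    have hb := bval_lt_two_pow b
    have hsum : ∑ j ∈ Finset.Icc 1 n, sMinus (n + 1) j (Fin.cons x a) (Fin.cons y b) =
        (1 : Matrix (Fin 2) (Fin 2) ℂ) x y * if bval b = bval a + 1 then 1 else 0 := by
      rw [← ih, Matrix.sum_apply, Finset.mul_sum]
      exact Finset.sum_congr rfl fun j hj => sMinus_succ_cons (Finset.mem_Icc.mp hj).2 x y a b
    rw [Matrix.sum_apply, Finset.sum_Icc_succ_top (by omega), hsum, sMinus_self_cons,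
      tens_sig10_apply, bval_cons, bval_cons]
    fin_cases x <;> fin_cases y <;> simp [sig01] <;> grind

theorem tens_conjTranspose {n : ℕ} (M : Fin n → Matrix (Fin 2) (Fin 2) ℂ) :
    (tens M)ᴴ = tens fun k => (M k)ᴴ := by
  ext a b
  simp [tens]

theorem sig01_conjTranspose : sig01ᴴ = sig10 := by
  ext i j
  fin_cases i <;> fin_cases j <;> simp [sig01, sig10]

theorem sig10_conjTranspose : sig10ᴴ = sig01 := by
  rw [← sig01_conjTranspose, conjTranspose_conjTranspose]

theorem sMinus_conjTranspose (n j : ℕ) : (sMinus n j)ᴴ = sPlus n j := by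
  rw [sMinus, sPlus, tens_conjTranspose]
  congr 1
  ext1 k
  split_ifs
  exacts [conjTranspose_one, sig01_conjTranspose, sig10_conjTranspose]

theorem shift_operators_in_computational_basis (n : ℕ) (hn : 1 ≤ n) :
    (∀ a b : Fin n → Fin 2,
      (∑ j ∈ Finset.Icc 1 n, sMinus n j) a b = if bval b = bval a + 1 then 1 else 0) ∧
    (∑ j ∈ Finset.Icc 1 n, sPlus n j) = (∑ j ∈ Finset.Icc 1 n, sMinus n j)ᴴ ∧
    (∀ a b : Fin n → Fin 2,
      (∑ j ∈ Finset.Icc 1 n, sPlus n j) a b = if bval a = bval b + 1 then 1 else 0) := by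
  have hadj : (∑ j ∈ Finset.Icc 1 n, sPlus n j) = (∑ j ∈ Finset.Icc 1 n, sMinus n j)ᴴ := by
    simp only [conjTranspose_sum, sMinus_conjTranspose]
  refine ⟨sum_sMinus_apply n, hadj, fun a b => ?_⟩
  rw [hadj, conjTranspose_apply, sum_sMinus_apply]
  split_ifs <;> simp
end
end

section
/- (Lemma 8, part I: vanishing products.) Let n ≥ 2. For all indices with n ≥ j > j' ≥ 2, every mixed product vanishes: s_{j,n}^− s_{j',n}^− = s_{j',n}^− s_{j,n}^− = 0, s_{j,n}^+ s_{j',n}^+ = s_{j',n}^+ s_{j,n}^+ = 0, s_{j,n}^− s_{j',n}^+ = s_{j',n}^− s_{j,n}^+ = 0, and s_{j,n}^+ s_{j',n}^− = s_{j',n}^+ s_{j,n}^− = 0. Moreover, for every j ≥ 2, s_{j,n}^− s_{1,n}^+ = s_{1,n}^− s_{j,n}^+ = 0 and s_{j,n}^+ s_{1,n}^− = s_{1,n}^+ s_{j,n}^− = 0. -/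
/-!
STATEMENT 9 (Lemma 8, part I: vanishing products). Let n ≥ 2. For n ≥ j > j' ≥ 2 every
mixed product of s_{j,n}^± and s_{j',n}^± vanishes, and for j ≥ 2 all the mixed products
of s_{j,n}^± with s_{1,n}^∓ vanish.
-/

open Matrix

noncomputable section

theorem tens_mul {n : ℕ} (M N : Fin n → Matrix (Fin 2) (Fin 2) ℂ) :
    tens M * tens N = tens fun k => M k * N k := by
  ext a b
  simp only [tens, Matrix.mul_apply, Matrix.of_apply, ← Finset.prod_mul_distrib]
  rw [Finset.prod_univ_sum, Fintype.piFinset_univ]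

theorem tens_eq_zero {n : ℕ} {M : Fin n → Matrix (Fin 2) (Fin 2) ℂ} (k : Fin n)
    (hk : M k = 0) : tens M = 0 := by
  ext a b
  exact Finset.prod_eq_zero (Finset.mem_univ k) (by simp [hk])

theorem tens_mul_eq_zero {n : ℕ} {M N : Fin n → Matrix (Fin 2) (Fin 2) ℂ} (k : Fin n)
    (hk : M k * N k = 0) : tens M * tens N = 0 := by
  rw [tens_mul]
  exact tens_eq_zero k hk

theorem sig01_mul_self : sig01 * sig01 = 0 := by
  ext i j
  fin_cases i <;> fin_cases j <;> simp [sig01]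

theorem sig10_mul_self : sig10 * sig10 = 0 := by
  ext i j
  fin_cases i <;> fin_cases j <;> simp [sig10]

/-- Two `s^-` of index at least two both carry `sig10` in the last tensor factor. -/
theorem sMinus_mul_sMinus {n i j : ℕ} (hi : 2 ≤ i) (hj : 2 ≤ j) (hn : 2 ≤ n) :
    sMinus n i * sMinus n j = 0 := by
  refine tens_mul_eq_zero ⟨n - 1, by omega⟩ ?_
  rw [if_neg (by simp only; omega), if_neg (by simp only; omega),
    if_neg (by simp only; omega), if_neg (by simp only; omega), sig10_mul_self]

/-- Two `s^+` of index at least two both carry `sig01` in the last tensor factor. -/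
theorem sPlus_mul_sPlus {n i j : ℕ} (hi : 2 ≤ i) (hj : 2 ≤ j) (hn : 2 ≤ n) :
    sPlus n i * sPlus n j = 0 := by
  refine tens_mul_eq_zero ⟨n - 1, by omega⟩ ?_
  rw [if_neg (by simp only; omega), if_neg (by simp only; omega),
    if_neg (by simp only; omega), if_neg (by simp only; omega), sig01_mul_self]

/-- In tensor factor `n - min i j`, `s_i^-` and `s_j^+` carry the same nilpotent matrix. -/
theorem sMinus_mul_sPlus {n i j : ℕ} (hi : 1 ≤ i) (hj : 1 ≤ j) (hin : i ≤ n) (hjn : j ≤ n)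
    (hij : i ≠ j) : sMinus n i * sPlus n j = 0 := by
  rcases hij.lt_or_gt with h | h
  · refine tens_mul_eq_zero ⟨n - i, by omega⟩ ?_
    rw [if_neg (by simp only; omega), if_pos rfl,
      if_neg (by simp only; omega), if_neg (by simp only; omega), sig01_mul_self]
  · refine tens_mul_eq_zero ⟨n - j, by omega⟩ ?_
    rw [if_neg (by simp only; omega), if_neg (by simp only; omega),
      if_neg (by simp only; omega), if_pos rfl, sig10_mul_self]

/-- In tensor factor `n - min i j`, `s_i^+` and `s_j^-` carry the same nilpotent matrix. -/
theorem sPlus_mul_sMinus {n i j : ℕ} (hi : 1 ≤ i) (hj : 1 ≤ j) (hin : i ≤ n) (hjn : j ≤ n)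
    (hij : i ≠ j) : sPlus n i * sMinus n j = 0 := by
  rcases hij.lt_or_gt with h | h
  · refine tens_mul_eq_zero ⟨n - i, by omega⟩ ?_
    rw [if_neg (by simp only; omega), if_pos rfl,
      if_neg (by simp only; omega), if_neg (by simp only; omega), sig10_mul_self]
  · refine tens_mul_eq_zero ⟨n - j, by omega⟩ ?_
    rw [if_neg (by simp only; omega), if_neg (by simp only; omega),
      if_neg (by simp only; omega), if_pos rfl, sig01_mul_self]

theorem vanishing_products (n : ℕ) (hn : 2 ≤ n) :
    (∀ j j' : ℕ, 2 ≤ j' → j' < j → j ≤ n →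
      sMinus n j * sMinus n j' = 0 ∧ sMinus n j' * sMinus n j = 0 ∧
      sPlus n j * sPlus n j' = 0 ∧ sPlus n j' * sPlus n j = 0 ∧
      sMinus n j * sPlus n j' = 0 ∧ sMinus n j' * sPlus n j = 0 ∧
      sPlus n j * sMinus n j' = 0 ∧ sPlus n j' * sMinus n j = 0) ∧
    (∀ j : ℕ, 2 ≤ j → j ≤ n →
      sMinus n j * sPlus n 1 = 0 ∧ sMinus n 1 * sPlus n j = 0 ∧
      sPlus n j * sMinus n 1 = 0 ∧ sPlus n 1 * sMinus n j = 0) := by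
  refine ⟨fun j j' hj' hlt hjn => ⟨?_, ?_, ?_, ?_, ?_, ?_, ?_, ?_⟩,
    fun j hj hjn => ⟨?_, ?_, ?_, ?_⟩⟩
  · exact sMinus_mul_sMinus (by omega) (by omega) hn
  · exact sMinus_mul_sMinus (by omega) (by omega) hn
  · exact sPlus_mul_sPlus (by omega) (by omega) hn
  · exact sPlus_mul_sPlus (by omega) (by omega) hn
  · exact sMinus_mul_sPlus (by omega) (by omega) (by omega) (by omega) (by omega)
  · exact sMinus_mul_sPlus (by omega) (by omega) (by omega) (by omega) (by omega)
  · exact sPlus_mul_sMinus (by omega) (by omega) (by omega) (by omega) (by omega)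
  · exact sPlus_mul_sMinus (by omega) (by omega) (by omega) (by omega) (by omega)
  · exact sMinus_mul_sPlus (by omega) (by omega) (by omega) (by omega) (by omega)
  · exact sMinus_mul_sPlus (by omega) (by omega) (by omega) (by omega) (by omega)
  · exact sPlus_mul_sMinus (by omega) (by omega) (by omega) (by omega) (by omega)
  · exact sPlus_mul_sMinus (by omega) (by omega) (by omega) (by omega) (by omega)
end
end

section
/- (Commutator structure of the Hamiltonian terms.) Let n ≥ 2, λ ∈ ℝ, and set h_j := e^{iλ} s_j⁻ + e^{−iλ} s_j⁺. Then for n ≥ j > j' ≥ 2, [h_j, h_{j'}] = 0; and for every 2 ≤ j ≤ n, [h_j, h_1] = −I^{⊗(n−j)} ⊗ (e^{2iλ} σ01 ⊗ σ10^{⊗(j−2)} − e^{−2iλ} σ10 ⊗ σ01^{⊗(j−2)}) ⊗ Z. -/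
/-!
STATEMENT 13 (Commutator structure of the Hamiltonian terms). Let n ≥ 2, λ ∈ ℝ,
h_j := e^{iλ} s_j⁻ + e^{−iλ} s_j⁺.  For n ≥ j > j' ≥ 2, [h_j, h_{j'}] = 0; and for
2 ≤ j ≤ n,
[h_j, h_1] = −I^{⊗(n−j)} ⊗ (e^{2iλ} σ01 ⊗ σ10^{⊗(j−2)} − e^{−2iλ} σ10 ⊗ σ01^{⊗(j−2)}) ⊗ Z.

Matrices on n qubits are indexed by bit strings `Fin n → Fin 2` (index 0 = leftmost
Kronecker factor); the right-hand side is expanded multilinearly: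
I^{⊗(n−j)} ⊗ σ01 ⊗ σ10^{⊗(j−2)} ⊗ Z has `I` at positions k < n−j, `σ01` at k = n−j,
`σ10` at n−j < k < n−1 and `Z` at k = n−1 (and analogously with σ01, σ10 swapped).
-/

open Matrix

noncomputable section

/-- The Pauli `Z` matrix. -/
def matZ : Matrix (Fin 2) (Fin 2) ℂ := !![1, 0; 0, -1]

def hTerm (n j : ℕ) (lam : ℝ) : Matrix (Fin n → Fin 2) (Fin n → Fin 2) ℂ :=
  Complex.exp (Complex.I * lam) • sMinus n j + Complex.exp (-(Complex.I * lam)) • sPlus n j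

theorem tens_update_apply {n : ℕ} (M : Fin n → Matrix (Fin 2) (Fin 2) ℂ) (k : Fin n)
    (A : Matrix (Fin 2) (Fin 2) ℂ) (a b : Fin n → Fin 2) :
    tens (Function.update M k A) a b
      = A (a k) (b k) * ∏ l ∈ Finset.univ.erase k, M l (a l) (b l) := by
  simp only [tens, Matrix.of_apply]
  rw [← Finset.mul_prod_erase _ _ (Finset.mem_univ k), Function.update_self]
  congr 1
  refine Finset.prod_congr rfl fun l hl => ?_
  rw [Function.update_of_ne (Finset.ne_of_mem_erase hl)]

theorem tens_update_sub {n : ℕ} (M : Fin n → Matrix (Fin 2) (Fin 2) ℂ) (k : Fin n)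
    (A B : Matrix (Fin 2) (Fin 2) ℂ) :
    tens (Function.update M k (A - B))
      = tens (Function.update M k A) - tens (Function.update M k B) := by
  ext a b
  simp only [Matrix.sub_apply, tens_update_apply, sub_mul]

theorem tens_update_neg {n : ℕ} (M : Fin n → Matrix (Fin 2) (Fin 2) ℂ) (k : Fin n)
    (A : Matrix (Fin 2) (Fin 2) ℂ) :
    tens (Function.update M k (-A)) = -tens (Function.update M k A) := by
  ext a b
  simp only [Matrix.neg_apply, tens_update_apply, neg_mul]

/-- The commutator with an operator acting on the single factor `k` is taken in that factor. -/
theorem tens_commutator_local {n : ℕ} (M : Fin n → Matrix (Fin 2) (Fin 2) ℂ) (k : Fin n)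
    (A : Matrix (Fin 2) (Fin 2) ℂ) :
    tens M * tens (Function.update 1 k A) - tens (Function.update 1 k A) * tens M
      = tens (Function.update M k (M k * A - A * M k)) := by
  rw [tens_update_sub, tens_mul, tens_mul]
  congr 2 <;> funext l <;> by_cases h : l = k
  all_goals first | (subst h; simp) | simp [h]

theorem sig10_sig01_commutator : sig10 * sig01 - sig01 * sig10 = -matZ := by
  ext i j
  fin_cases i <;> fin_cases j <;> simp [sig01, sig10, matZ]

theorem sMinus_one {n : ℕ} (k : Fin n) (hk : (k : ℕ) = n - 1) :
    sMinus n 1 = tens (Function.update 1 k sig01) := by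
  unfold sMinus
  congr 1
  funext l
  by_cases h : l = k
  · subst h; simp [hk]
  · have : (l : ℕ) < n - 1 := by have := Fin.val_ne_of_ne h; omega
    simp [h, this]

theorem sPlus_one {n : ℕ} (k : Fin n) (hk : (k : ℕ) = n - 1) :
    sPlus n 1 = tens (Function.update 1 k sig10) := by
  unfold sPlus
  congr 1
  funext l
  by_cases h : l = k
  · subst h; simp [hk]
  · have : (l : ℕ) < n - 1 := by have := Fin.val_ne_of_ne h; omega
    simp [h, this]

section Vanishing

variable {n j j' : ℕ}

theorem sMinus_mul_sMinus_s13 (hj : 2 ≤ j) (hj' : 2 ≤ j') (h : j ≤ n) (h' : j' ≤ n) :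
    sMinus n j * sMinus n j' = 0 := by
  rw [sMinus, sMinus, tens_mul]
  refine tens_eq_zero ⟨n - 1, by omega⟩ ?_
  simp (disch := omega) only [if_neg, sig10_mul_self]

theorem sPlus_mul_sPlus_s13 (hj : 2 ≤ j) (hj' : 2 ≤ j') (h : j ≤ n) (h' : j' ≤ n) :
    sPlus n j * sPlus n j' = 0 := by
  rw [sPlus, sPlus, tens_mul]
  refine tens_eq_zero ⟨n - 1, by omega⟩ ?_
  simp (disch := omega) only [if_neg, sig01_mul_self]

theorem sMinus_mul_sPlus_of_lt (hj' : 2 ≤ j') (hlt : j' < j) (h : j ≤ n) :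
    sMinus n j * sPlus n j' = 0 := by
  rw [sMinus, sPlus, tens_mul]
  refine tens_eq_zero ⟨n - j', by omega⟩ ?_
  simp (disch := omega) only [if_neg, if_true, sig10_mul_self]

theorem sPlus_mul_sMinus_of_gt (hj' : 2 ≤ j') (hlt : j' < j) (h : j ≤ n) :
    sPlus n j' * sMinus n j = 0 := by
  rw [sMinus, sPlus, tens_mul]
  refine tens_eq_zero ⟨n - j', by omega⟩ ?_
  simp (disch := omega) only [if_neg, if_true, sig10_mul_self]

theorem sPlus_mul_sMinus_of_lt (hj' : 2 ≤ j') (hlt : j' < j) (h : j ≤ n) :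
    sPlus n j * sMinus n j' = 0 := by
  rw [sMinus, sPlus, tens_mul]
  refine tens_eq_zero ⟨n - j', by omega⟩ ?_
  simp (disch := omega) only [if_neg, if_true, sig01_mul_self]

theorem sMinus_mul_sPlus_of_gt (hj' : 2 ≤ j') (hlt : j' < j) (h : j ≤ n) :
    sMinus n j' * sPlus n j = 0 := by
  rw [sMinus, sPlus, tens_mul]
  refine tens_eq_zero ⟨n - j', by omega⟩ ?_
  simp (disch := omega) only [if_neg, if_true, sig01_mul_self]

end Vanishing

section LastSite

variable {n j : ℕ}

theorem sMinus_commutator_sMinus_one (hj : 2 ≤ j) (h : j ≤ n) :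
    sMinus n j * sMinus n 1 - sMinus n 1 * sMinus n j
      = -tens (fun k : Fin n => if (k : ℕ) < n - j then 1
          else if (k : ℕ) = n - j then sig01
          else if (k : ℕ) < n - 1 then sig10 else matZ) := by
  have hlt : n - 1 < n := by omega
  rw [sMinus_one ⟨n - 1, hlt⟩ rfl, sMinus, tens_commutator_local]
  simp (disch := omega) only [if_neg]
  rw [sig10_sig01_commutator, tens_update_neg]
  congr 2
  funext l
  by_cases hl : l = ⟨n - 1, hlt⟩
  · subst hl
    simp (disch := omega) only [if_neg, Function.update_self]
  · have : (l : ℕ) < n - 1 := by have := Fin.val_ne_of_ne hl; simp only at this; omega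
    simp [hl, this]

theorem sPlus_commutator_sPlus_one (hj : 2 ≤ j) (h : j ≤ n) :
    sPlus n j * sPlus n 1 - sPlus n 1 * sPlus n j
      = tens (fun k : Fin n => if (k : ℕ) < n - j then 1
          else if (k : ℕ) = n - j then sig10
          else if (k : ℕ) < n - 1 then sig01 else matZ) := by
  have hlt : n - 1 < n := by omega
  have hZ : sig01 * sig10 - sig10 * sig01 = matZ := by
    rw [← neg_sub, sig10_sig01_commutator, neg_neg]
  rw [sPlus_one ⟨n - 1, hlt⟩ rfl, sPlus, tens_commutator_local]
  simp (disch := omega) only [if_neg]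
  rw [hZ]
  congr 1
  funext l
  by_cases hl : l = ⟨n - 1, hlt⟩
  · subst hl
    simp (disch := omega) only [if_neg, Function.update_self]
  · have : (l : ℕ) < n - 1 := by have := Fin.val_ne_of_ne hl; simp only at this; omega
    simp [hl, this]

theorem sMinus_commutator_sPlus_one (hj : 2 ≤ j) (h : j ≤ n) :
    sMinus n j * sPlus n 1 - sPlus n 1 * sMinus n j = 0 := by
  have hlt : n - 1 < n := by omega
  rw [sPlus_one ⟨n - 1, hlt⟩ rfl, sMinus, tens_commutator_local]
  refine tens_eq_zero ⟨n - 1, hlt⟩ ?_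
  simp (disch := omega) only [if_neg, Function.update_self, sub_self]

theorem sPlus_commutator_sMinus_one (hj : 2 ≤ j) (h : j ≤ n) :
    sPlus n j * sMinus n 1 - sMinus n 1 * sPlus n j = 0 := by
  have hlt : n - 1 < n := by omega
  rw [sMinus_one ⟨n - 1, hlt⟩ rfl, sPlus, tens_commutator_local]
  refine tens_eq_zero ⟨n - 1, hlt⟩ ?_
  simp (disch := omega) only [if_neg, Function.update_self, sub_self]

end LastSite

/-- The commutator of two Hamiltonian terms, expanded bilinearly. -/
theorem hTerm_commutator (n j j' : ℕ) (lam : ℝ) :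
    hTerm n j lam * hTerm n j' lam - hTerm n j' lam * hTerm n j lam
      = Complex.exp (2 * Complex.I * lam) •
          (sMinus n j * sMinus n j' - sMinus n j' * sMinus n j)
        + (sMinus n j * sPlus n j' - sPlus n j' * sMinus n j)
        + (sPlus n j * sMinus n j' - sMinus n j' * sPlus n j)
        + Complex.exp (-(2 * Complex.I * lam)) •
          (sPlus n j * sPlus n j' - sPlus n j' * sPlus n j) := by
  have hpos : Complex.exp (2 * Complex.I * lam)
      = Complex.exp (Complex.I * lam) * Complex.exp (Complex.I * lam) := by
    rw [← Complex.exp_add]; ring_nf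
  have hneg : Complex.exp (-(2 * Complex.I * lam))
      = Complex.exp (-(Complex.I * lam)) * Complex.exp (-(Complex.I * lam)) := by
    rw [← Complex.exp_add]; ring_nf
  have hone : Complex.exp (Complex.I * lam) * Complex.exp (-(Complex.I * lam)) = 1 := by
    rw [← Complex.exp_add, add_neg_cancel, Complex.exp_zero]
  have hone' : Complex.exp (-(Complex.I * lam)) * Complex.exp (Complex.I * lam) = 1 := by
    rw [mul_comm, hone]
  simp only [hTerm, add_mul, mul_add, smul_mul_smul_comm, hone, hone', one_smul, hpos, hneg,
    smul_sub]
  abel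

theorem commutator_structure (n : ℕ) (hn : 2 ≤ n) (lam : ℝ) :
    (∀ j j' : ℕ, 2 ≤ j' → j' < j → j ≤ n →
      hTerm n j lam * hTerm n j' lam - hTerm n j' lam * hTerm n j lam = 0) ∧
    (∀ j : ℕ, 2 ≤ j → j ≤ n →
      hTerm n j lam * hTerm n 1 lam - hTerm n 1 lam * hTerm n j lam
        = -(Complex.exp (2 * Complex.I * lam) •
              tens (fun k => if (k : ℕ) < n - j then 1
                else if (k : ℕ) = n - j then sig01
                else if (k : ℕ) < n - 1 then sig10 else matZ)
            - Complex.exp (-(2 * Complex.I * lam)) •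
              tens (fun k => if (k : ℕ) < n - j then 1
                else if (k : ℕ) = n - j then sig10
                else if (k : ℕ) < n - 1 then sig01 else matZ))) := by
  refine ⟨fun j j' hj' hlt h => ?_, fun j hj h => ?_⟩
  · have hj : 2 ≤ j := by omega
    have h' : j' ≤ n := by omega
    rw [hTerm_commutator, sMinus_mul_sMinus_s13 hj hj' h h', sMinus_mul_sMinus_s13 hj' hj h' h,
      sPlus_mul_sPlus_s13 hj hj' h h', sPlus_mul_sPlus_s13 hj' hj h' h,
      sMinus_mul_sPlus_of_lt hj' hlt h, sPlus_mul_sMinus_of_gt hj' hlt h,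
      sPlus_mul_sMinus_of_lt hj' hlt h, sMinus_mul_sPlus_of_gt hj' hlt h]
    simp
  · rw [hTerm_commutator, sMinus_commutator_sMinus_one hj h, sPlus_commutator_sPlus_one hj h,
      sMinus_commutator_sPlus_one hj h, sPlus_commutator_sMinus_one hj h, smul_neg]
    abel
end
end

section
/- (Hermiticity of the discretized advection Hamiltonian with periodic boundary conditions.) Let n ≥ 1, v ∈ ℝ, l > 0, and define the 2^n × 2^n matrix H_P := −(i v/(2l)) (S⁻ − S⁺ + σ10^{⊗n} − σ01^{⊗n}), where S⁻ := ∑_{j=1}^n s_j⁻ and S⁺ := ∑_{j=1}^n s_j⁺. Then H_P is Hermitian: H_P† = H_P. -/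
/-!
STATEMENT 16 (Hermiticity of the discretized advection Hamiltonian with periodic BC).
Let n ≥ 1, v ∈ ℝ, l > 0 and H_P := −(iv/(2l)) (S⁻ − S⁺ + σ10^{⊗n} − σ01^{⊗n}) with
S⁻ := ∑_{j=1}^n s_j⁻ and S⁺ := ∑_{j=1}^n s_j⁺.  Then H_P† = H_P.
-/

open Matrix

noncomputable section

theorem sPlus_conjTranspose (n j : ℕ) : (sPlus n j)ᴴ = sMinus n j := by
  rw [← sMinus_conjTranspose, conjTranspose_conjTranspose]

theorem advection_hamiltonian_hermitian (n : ℕ) (hn : 1 ≤ n) (v l : ℝ) (hl : 0 < l) :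
    ((-(Complex.I * v / (2 * l))) •
        ((∑ j ∈ Finset.Icc 1 n, sMinus n j) - (∑ j ∈ Finset.Icc 1 n, sPlus n j)
          + tens (fun _ : Fin n => sig10) - tens (fun _ : Fin n => sig01)))ᴴ
      = (-(Complex.I * v / (2 * l))) •
        ((∑ j ∈ Finset.Icc 1 n, sMinus n j) - (∑ j ∈ Finset.Icc 1 n, sPlus n j)
          + tens (fun _ : Fin n => sig10) - tens (fun _ : Fin n => sig01)) := by
  have hc : star (-(Complex.I * v / (2 * l))) = Complex.I * v / (2 * l) := by
    simp [neg_div]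
  rw [conjTranspose_smul, hc]
  simp only [conjTranspose_sub, conjTranspose_add, conjTranspose_sum, sMinus_conjTranspose,
    sPlus_conjTranspose, tens_conjTranspose, sig01_conjTranspose, sig10_conjTranspose]
  module
end
end
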